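/- arXiv:1403.6661 — 2 statements merged into one kernel-verified Lean document; each statement's English description precedes it below -/
import Mathlib

section
/- Let ν be a quasi-stationary channel from A to B, i.e., for every probability measure η on A that is stationary under T_A, the hookup ην is stationary under T_{AB}. Then for every probability measure μ on A that is recurrent and AMS under T_A, the hookup μν is recurrent and AMS under T_{AB}. -/
open MeasureTheory ProbabilityTheory Filter

/-- A probability measure `η` is stationary under `T` if `η (T ⁻¹' F) = η F`
for all measurable `F`. -/
def Stationary {α : Type*} [MeasurableSpace α] (T : α → α)
    (η : MeasureTheory.Measure α) : Prop :=
  ∀ F : Set α, MeasurableSet F → η (T ⁻¹' F) = η F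

/-- A probability measure `η` is recurrent under `T` if
`η (F \ ⋃_{k ≥ 1} T^{-k} F) = 0` for all measurable `F`. -/
def Recurrent {α : Type*} [MeasurableSpace α] (T : α → α)
    (η : MeasureTheory.Measure α) : Prop :=
  ∀ F : Set α, MeasurableSet F → η (F \ ⋃ k : ℕ, (T^[k + 1]) ⁻¹' F) = 0

/-- A probability measure `η` is asymptotically mean stationary (AMS) under `T` if the
Cesàro averages `(1/n) ∑_{k<n} η (T^{-k} F)` converge for every measurable `F`. -/
def IsAMS {α : Type*} [MeasurableSpace α] (T : α → α)
    (η : MeasureTheory.Measure α) : Prop :=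
  ∀ F : Set α, MeasurableSet F → ∃ L : ℝ,
    Filter.Tendsto
      (fun n : ℕ => (∑ k ∈ Finset.range n, (η ((T^[k]) ⁻¹' F)).toReal) / (n : ℝ))
      Filter.atTop (nhds L)

/-- `η'` is the stationary mean of `η` under `T`: the Cesàro averages
`(1/n) ∑_{k<n} η (T^{-k} F)` converge to `η' F` for every measurable `F`. -/
def IsStationaryMean {α : Type*} [MeasurableSpace α] (T : α → α)
    (η η' : MeasureTheory.Measure α) : Prop :=
  ∀ F : Set α, MeasurableSet F →
    Filter.Tendsto
      (fun n : ℕ => (∑ k ∈ Finset.range n, (η ((T^[k]) ⁻¹' F)).toReal) / (n : ℝ))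
      Filter.atTop (nhds ((η' F).toReal))

/-- A probability measure `η` is ergodic under `T` if every strictly invariant
measurable set has measure `0` or `1`. -/
def ErgodicShift {α : Type*} [MeasurableSpace α] (T : α → α)
    (η : MeasureTheory.Measure α) : Prop :=
  ∀ F : Set α, MeasurableSet F → T ⁻¹' F = F → η F = 0 ∨ η F = 1

open scoped Topology ENNReal

section VitaliHahnSaks

variable {α : Type*} [MeasurableSpace α]

/-- Additivity of a finite measure over a subfamily of a disjoint sequence, coded by a point of
the Cantor space. -/
lemma measureReal_iUnion_ite (ρ : Measure α) [IsFiniteMeasure ρ] {f : ℕ → Set α}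
    (hf : ∀ i, MeasurableSet (f i)) (hd : Pairwise (Function.onFun Disjoint f)) (s : ℕ → Bool) :
    ρ.real (⋃ i, if s i then f i else ∅) = ∑' i, if s i then ρ.real (f i) else 0 := by
  rw [measureReal_def, measure_iUnion, ENNReal.tsum_toReal_eq]
  · congr 1 with i
    split_ifs <;> simp [measureReal_def]
  · intro i
    exact measure_ne_top _ _
  · intro i j hij
    have := hd hij
    simp only [Function.onFun] at this ⊢
    split_ifs <;> simp [this]
  · intro i
    split_ifs
    exacts [hf i, MeasurableSet.empty]

lemma summable_measureReal_of_disjoint (ρ : Measure α) [IsFiniteMeasure ρ] {f : ℕ → Set α}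
    (hf : ∀ i, MeasurableSet (f i)) (hd : Pairwise (Function.onFun Disjoint f)) :
    Summable fun i => ρ.real (f i) := by
  refine ENNReal.summable_toReal ?_
  rw [← measure_iUnion hd hf]
  exact measure_ne_top _ _

lemma continuous_measureReal_iUnion_ite (ρ : Measure α) [IsFiniteMeasure ρ] {f : ℕ → Set α}
    (hf : ∀ i, MeasurableSet (f i)) (hd : Pairwise (Function.onFun Disjoint f)) :
    Continuous fun s : ℕ → Bool => ρ.real (⋃ i, if s i then f i else ∅) := by
  simp_rw [measureReal_iUnion_ite ρ hf hd]
  refine continuous_tsum (fun i => ?_) (summable_measureReal_of_disjoint ρ hf hd) fun i s => ?_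
  · exact (continuous_of_discreteTopology
      (f := fun b : Bool => if b then ρ.real (f i) else 0)).comp (continuous_apply i)
  · split_ifs <;> simp [abs_of_nonneg measureReal_nonneg]

/-- If a sequence of finite measures converges setwise, then the tails of a disjoint sequence of
sets are eventually uniformly small. -/
lemma exists_measureReal_tail_le (μ : ℕ → Measure α) [∀ n, IsFiniteMeasure (μ n)]
    (h : ∀ F, MeasurableSet F → ∃ L : ℝ, Tendsto (fun n => (μ n).real F) atTop (𝓝 L))
    {f : ℕ → Set α} (hf : ∀ i, MeasurableSet (f i)) (hd : Pairwise (Function.onFun Disjoint f))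
    {ε : ℝ} (hε : 0 < ε) :
    ∃ j N, ∀ n ≥ N, (μ n).real (⋃ i ≥ j, f i) ≤ ε := by
  set φ : ℕ → (ℕ → Bool) → ℝ := fun n s => (μ n).real (⋃ i, if s i then f i else ∅) with hφ
  have hc : ∀ n, Continuous (φ n) := fun n => continuous_measureReal_iUnion_ite _ hf hd
  have hδ : 0 < ε / 3 := by positivity
  obtain ⟨N, s, hs⟩ := nonempty_interior_of_iUnion_of_closed
    (f := fun N => {s | ∀ n ≥ N, |φ n s - φ N s| ≤ ε / 3})
    (fun N => by
      simp only [Set.ofPred_forall]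
      exact isClosed_iInter fun n => isClosed_iInter fun _ =>
        isClosed_le ((hc n).sub (hc N)).abs continuous_const)
    (by
      refine Set.eq_univ_of_forall fun s => Set.mem_iUnion.2 ?_
      obtain ⟨L, hL⟩ := h (⋃ i, if s i then f i else ∅) (MeasurableSet.iUnion fun i => by
        split_ifs
        exacts [hf i, MeasurableSet.empty])
      obtain ⟨N, hN⟩ := Metric.cauchySeq_iff'.1 hL.cauchySeq (ε / 3) hδ
      exact ⟨N, fun n hn => (hN n hn).le⟩)
  set t : Bool → ℕ → ℕ → Bool := fun b j i => if i < j then s i else b with ht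
  have htend : ∀ b, Tendsto (t b) atTop (𝓝 s) := fun b => tendsto_pi_nhds.2 fun i =>
    tendsto_const_nhds.congr' ((eventually_gt_atTop i).mono fun j hj => by simp [ht, hj])
  have hmem : ∀ b, ∀ᶠ j in atTop, ∀ n ≥ N, |φ n (t b j) - φ N (t b j)| ≤ ε / 3 := fun b =>
    ((htend b).eventually (isOpen_interior.mem_nhds hs)).mono fun j hj => interior_subset hj
  have hsplit : ∀ n j, φ n (t true j) = φ n (t false j) + (μ n).real (⋃ i ≥ j, f i) := by
    intro n j
    simp only [hφ]
    rw [← measureReal_union (h₂ := measure_ne_top _ _)]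
    · congr 1
      ext x
      simp only [ht, Set.mem_iUnion, Set.mem_union]
      constructor
      · rintro ⟨i, hi⟩
        by_cases hij : i < j
        · exact Or.inl ⟨i, by simpa [hij] using hi⟩
        · exact Or.inr ⟨i, not_lt.1 hij, by simpa [hij] using hi⟩
      · rintro (⟨i, hi⟩ | ⟨i, hij, hi⟩)
        · by_cases hij : i < j
          · exact ⟨i, by simpa [hij] using hi⟩
          · simp [hij] at hi
        · exact ⟨i, by simpa [not_lt.2 hij] using hi⟩
    · simp only [Set.disjoint_iUnion_left, Set.disjoint_iUnion_right]
      intro i hi k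
      by_cases hk : k < j
      · simp only [ht, hk, if_true]
        split_ifs
        · exact hd (by lia)
        · simp
      · simp [ht, hk]
    · exact MeasurableSet.iUnion fun i => MeasurableSet.iUnion fun _ => hf i
  have hsmall : ∀ᶠ j in atTop, φ N (t true j) - φ N (t false j) < ε / 3 := by
    have h1 := (((hc N).tendsto s).comp (htend true)).sub (((hc N).tendsto s).comp (htend false))
    rw [sub_self] at h1
    exact h1.eventually (gt_mem_nhds hδ)
  obtain ⟨j, h1, h2, h3⟩ := ((hmem true).and ((hmem false).and hsmall)).exists
  refine ⟨j, N, fun n hn => ?_⟩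
  have := abs_le.1 (h1 n hn)
  have := abs_le.1 (h2 n hn)
  linarith [hsplit n j]

/-- **Vitali–Hahn–Saks theorem** for nonnegative measures: a setwise convergent sequence of finite
measures converges to a measure. -/
theorem exists_measure_tendsto_of_setwise (μ : ℕ → Measure α) [∀ n, IsFiniteMeasure (μ n)]
    (h : ∀ F, MeasurableSet F → ∃ L : ℝ, Tendsto (fun n => (μ n).real F) atTop (𝓝 L)) :
    ∃ m : Measure α, ∀ F, MeasurableSet F → Tendsto (fun n => μ n F) atTop (𝓝 (m F)) := by
  have h' : ∀ F, MeasurableSet F → ∃ L : ℝ≥0∞, Tendsto (fun n => μ n F) atTop (𝓝 L) := by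
    intro F hF
    obtain ⟨L, hL⟩ := h F hF
    refine ⟨ENNReal.ofReal L, (ENNReal.tendsto_ofReal hL).congr fun n => ?_⟩
    exact ENNReal.ofReal_toReal (measure_ne_top _ _)
  choose L hL using h'
  have hadd : ∀ ⦃f : ℕ → Set α⦄ (hf : ∀ i, MeasurableSet (f i)),
      Pairwise (Function.onFun Disjoint f) →
        L (⋃ i, f i) (MeasurableSet.iUnion hf) = ∑' i, L (f i) (hf i) := by
    intro f hf hd
    have hfin : ∀ j : ℕ, Tendsto (fun n => ∑ i ∈ Finset.range j, μ n (f i)) atTop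
        (𝓝 (∑ i ∈ Finset.range j, L (f i) (hf i))) := fun j =>
      tendsto_finsetSum _ fun i _ => hL (f i) (hf i)
    apply le_antisymm
    · refine ENNReal.le_of_forall_pos_le_add fun ε hε _ => ?_
      obtain ⟨j, N, hN⟩ := exists_measureReal_tail_le μ h hf hd (ε := ε) (by exact_mod_cast hε)
      refine (le_of_tendsto_of_tendsto (hL _ _) ((hfin j).add_const (ε : ℝ≥0∞)) ?_).trans
        (add_le_add_left (ENNReal.sum_le_tsum _) _)
      filter_upwards [eventually_ge_atTop N] with n hn
      have hsub : (⋃ i, f i) ⊆ (⋃ i ∈ Finset.range j, f i) ∪ ⋃ i ≥ j, f i := by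
        refine Set.iUnion_subset fun i => ?_
        rcases lt_or_ge i j with hi | hi
        · exact (Set.subset_biUnion_of_mem (u := f) (by simpa using hi)).trans
            Set.subset_union_left
        · exact (Set.subset_biUnion_of_mem (s := {i | i ≥ j}) (u := f) hi).trans
            Set.subset_union_right
      refine (measure_mono hsub).trans ((measure_union_le _ _).trans ?_)
      refine add_le_add (measure_biUnion_finset_le _ _) ?_
      rw [← ENNReal.ofReal_toReal (measure_ne_top (μ n) _), ← ENNReal.ofReal_coe_nnreal]
      exact ENNReal.ofReal_le_ofReal (hN n hn)
    · rw [ENNReal.tsum_eq_iSup_nat]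
      refine iSup_le fun j => le_of_tendsto_of_tendsto' (hfin j) (hL _ _) fun n => ?_
      rw [measure_iUnion hd hf]
      exact ENNReal.sum_le_tsum _
  refine ⟨Measure.ofMeasurable L ?_ hadd, fun F hF => ?_⟩
  · refine tendsto_nhds_unique (hL ∅ MeasurableSet.empty) ?_
    simp
  · rw [Measure.ofMeasurable_apply F hF]
    exact hL F hF

end VitaliHahnSaks

section Shift

variable {α : Type*} [MeasurableSpace α] {T : α → α}

lemma Stationary.measurePreserving {η : Measure α} (h : Stationary T η) (hT : Measurable T) :
    MeasurePreserving T η η :=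
  ⟨hT, Measure.ext fun F hF => by rw [Measure.map_apply hT hF, h F hF]⟩

/-- An AMS probability measure has a stationary mean, which is a stationary probability measure. -/
lemma IsAMS.exists_isStationaryMean (hT : Measurable T) {μ : Measure α} [IsProbabilityMeasure μ]
    (h : IsAMS T μ) :
    ∃ m : Measure α, IsProbabilityMeasure m ∧ Stationary T m ∧ IsStationaryMean T μ m := by
  set ρ : ℕ → Measure α := fun n =>
    (n : ℝ≥0∞)⁻¹ • ∑ k ∈ Finset.range n, μ.map T^[k] with hρ
  have hreal : ∀ n F, MeasurableSet F →
      (ρ n).real F = (∑ k ∈ Finset.range n, (μ (T^[k] ⁻¹' F)).toReal) / (n : ℝ) := by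
    intro n F hF
    simp only [hρ, measureReal_def, Measure.smul_apply, Measure.finsetSum_apply, smul_eq_mul,
      ENNReal.toReal_mul, ENNReal.toReal_inv, ENNReal.toReal_natCast]
    rw [ENNReal.toReal_sum fun k _ => by
      rw [Measure.map_apply (hT.iterate k) hF]; exact measure_ne_top _ _, div_eq_inv_mul]
    congr 1
    exact Finset.sum_congr rfl fun k _ => by rw [Measure.map_apply (hT.iterate k) hF]
  have hfin : ∀ n, IsFiniteMeasure (ρ n) := by
    intro n
    refine ⟨?_⟩
    simp only [hρ, Measure.smul_apply, Measure.finsetSum_apply, smul_eq_mul]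
    rcases Nat.eq_zero_or_pos n with rfl | hn
    · simp
    · refine ENNReal.mul_lt_top (by simp [hn]) (ENNReal.sum_lt_top.2 fun k _ => ?_)
      rw [Measure.map_apply (hT.iterate k) MeasurableSet.univ]
      exact measure_lt_top _ _
  obtain ⟨m, hm⟩ := exists_measure_tendsto_of_setwise ρ fun F hF => by
    simpa only [hreal _ F hF] using h F hF
  have huniv : m Set.univ = 1 := by
    refine tendsto_nhds_unique (hm _ MeasurableSet.univ) (tendsto_const_nhds.congr' ?_)
    filter_upwards [eventually_gt_atTop 0] with n hn
    simp only [hρ, Measure.smul_apply, Measure.finsetSum_apply, smul_eq_mul,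
      Measure.map_apply (hT.iterate _) MeasurableSet.univ, Set.preimage_univ, measure_univ,
      Finset.sum_const, Finset.card_range, nsmul_eq_mul, mul_one]
    exact (ENNReal.inv_mul_cancel (by exact_mod_cast hn.ne') (ENNReal.natCast_ne_top n)).symm
  have hprob : IsProbabilityMeasure m := ⟨huniv⟩
  have hmean : IsStationaryMean T μ m := fun F hF => by
    have := (ENNReal.tendsto_toReal (measure_ne_top m F)).comp (hm F hF)
    exact this.congr fun n => hreal n F hF
  refine ⟨m, hprob, fun F hF => ?_, hmean⟩
  rw [← ENNReal.toReal_eq_toReal_iff' (measure_ne_top _ _) (measure_ne_top _ _)]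
  refine tendsto_nhds_unique (hmean _ (hT hF)) ?_
  have hbound : Tendsto (fun n : ℕ =>
      ((μ (T^[n] ⁻¹' F)).toReal - (μ F).toReal) / (n : ℝ)) atTop (𝓝 0) := by
    refine squeeze_zero_norm (fun n => ?_)
      (tendsto_const_nhds.div_atTop tendsto_natCast_atTop_atTop : Tendsto
        (fun n : ℕ => (1 : ℝ) / (n : ℝ)) atTop (𝓝 0))
    rw [norm_div, Real.norm_natCast]
    gcongr
    have h1 := measureReal_le_one (μ := μ) (s := T^[n] ⁻¹' F)
    have h2 := measureReal_le_one (μ := μ) (s := F)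
    have h3 := measureReal_nonneg (μ := μ) (s := T^[n] ⁻¹' F)
    have h4 := measureReal_nonneg (μ := μ) (s := F)
    simp only [measureReal_def] at h1 h2 h3 h4
    rw [Real.norm_eq_abs, abs_le]
    constructor <;> linarith
  have hsum := (hmean F hF).add hbound
  rw [add_zero] at hsum
  refine hsum.congr fun n => ?_
  rw [← add_div]
  congr 1
  have hshift : ∀ k, T^[k] ⁻¹' (T ⁻¹' F) = T^[k + 1] ⁻¹' F := fun k => by
    rw [Function.iterate_succ', Set.preimage_comp]
  simp only [hshift]
  have h1 := Finset.sum_range_succ (fun k => (μ (T^[k] ⁻¹' F)).toReal) n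
  have h2 := Finset.sum_range_succ' (fun k => (μ (T^[k] ⁻¹' F)).toReal) n
  simp only [Function.iterate_zero, Set.preimage_id] at h2
  linarith

/-- A probability measure and its stationary mean agree on invariant sets. -/
lemma IsStationaryMean.measure_eq_of_invariant {μ m : Measure α} [IsFiniteMeasure μ]
    [IsFiniteMeasure m] (h : IsStationaryMean T μ m) {G : Set α} (hG : MeasurableSet G)
    (hinv : T ⁻¹' G = G) : μ G = m G := by
  have hit : ∀ k, T^[k] ⁻¹' G = G := fun k => by
    rw [Set.preimage_iterate_eq]
    exact Function.iterate_fixed hinv k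
  rw [← ENNReal.toReal_eq_toReal_iff' (measure_ne_top _ _) (measure_ne_top _ _)]
  refine tendsto_nhds_unique (tendsto_const_nhds.congr' ?_) (h G hG)
  filter_upwards [eventually_gt_atTop 0] with n hn
  have : (n : ℝ) ≠ 0 := by exact_mod_cast hn.ne'
  simp [hit, this]

/-- A recurrent AMS measure is absolutely continuous with respect to its stationary mean. -/
lemma Recurrent.absolutelyContinuous (hT : Measurable T) {μ m : Measure α} [IsFiniteMeasure μ]
    [IsFiniteMeasure m] (hrec : Recurrent T μ) (hm : Stationary T m)
    (hmean : IsStationaryMean T μ m) : μ ≪ m := by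
  refine Measure.AbsolutelyContinuous.mk fun F hF hF0 => ?_
  set V : ℕ → Set α := fun j => ⋃ k, T^[j + k] ⁻¹' F with hV
  have hVmeas : ∀ j, MeasurableSet (V j) := fun j =>
    MeasurableSet.iUnion fun k => hT.iterate _ hF
  have hVanti : Antitone V := fun i j hij => Set.iUnion_subset fun k =>
    Set.subset_iUnion_of_subset (j - i + k) (by rw [show i + (j - i + k) = j + k by lia])
  have hVpre : ∀ j k, T^[k] ⁻¹' V j = V (j + k) := fun j k => by
    simp only [hV, Set.preimage_iUnion, ← Set.preimage_comp, ← Function.iterate_add]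
    exact Set.iUnion_congr fun i => by rw [show j + i + k = j + k + i by lia]
  have hwander : ∀ j, μ (V j \ V (j + 1)) = 0 := by
    intro j
    have h := hrec (V j \ V (j + 1)) ((hVmeas j).diff (hVmeas (j + 1)))
    rwa [sdiff_eq_left.2] at h
    refine Set.disjoint_iUnion_right.2 fun k => Set.disjoint_left.2 fun x hx hx' => hx.2 ?_
    have hx'' : x ∈ T^[k + 1] ⁻¹' V j := hx'.1
    rw [hVpre] at hx''
    exact hVanti (by lia) hx''
  have hinv : T ⁻¹' (⋂ j, V j) = ⋂ j, V j := by
    rw [Set.preimage_iInter]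
    have h1 : ∀ j, T ⁻¹' V j = V (j + 1) := fun j => hVpre j 1
    simp only [h1]
    exact Set.Subset.antisymm
      (Set.subset_iInter fun j => (Set.iInter_subset _ j).trans (hVanti (Nat.le_succ j)))
      (Set.subset_iInter fun j => Set.iInter_subset _ (j + 1))
  have hlim : μ (⋂ j, V j) = 0 := by
    rw [hmean.measure_eq_of_invariant (MeasurableSet.iInter hVmeas) hinv]
    refine measure_mono_null (Set.iInter_subset V 0) (measure_iUnion_null fun k => ?_)
    rw [((hm.measurePreserving hT).iterate _).measure_preimage hF.nullMeasurableSet, hF0]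
  refine measure_mono_null (t := (⋃ j, V j \ V (j + 1)) ∪ ⋂ j, V j) (fun x hx => ?_)
    (measure_union_null (measure_iUnion_null hwander) hlim)
  by_contra hcon
  simp only [Set.mem_union, Set.mem_iUnion, Set.mem_sdiff, not_or, not_exists, not_and,
    not_not] at hcon
  refine hcon.2 (Set.mem_iInter.2 fun j => ?_)
  induction j with
  | zero => exact Set.mem_iUnion.2 ⟨0, hx⟩
  | succ j ih => exact hcon.1 j ih

/-- A measure dominated by a stationary finite measure is recurrent. -/
lemma Stationary.recurrent_of_absolutelyContinuous (hT : Measurable T) {η m : Measure α}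
    [IsFiniteMeasure m] (hm : Stationary T m) (hac : η ≪ m) : Recurrent T η := by
  intro F hF
  refine hac ?_
  have h := (hm.measurePreserving hT).conservative.ae_mem_imp_frequently_image_mem
    hF.nullMeasurableSet
  refine measure_mono_null (fun x hx => ?_) (ae_iff.1 h)
  simp only [Set.mem_ofPred_eq]
  intro hfreq
  obtain ⟨n, hn, hnF⟩ := (frequently_atTop.1 (hfreq hx.1)) 1
  exact hx.2 (Set.mem_iUnion.2 ⟨n - 1, by rwa [Nat.sub_add_cancel hn]⟩)

/-- The Birkhoff averages of an indicator function converge in measure. -/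
lemma MeasureTheory.MeasurePreserving.exists_tendstoInMeasure_average_indicator {m : Measure α}
    [IsFiniteMeasure m] (hT : MeasurePreserving T m m) {F : Set α} (hF : MeasurableSet F) :
    ∃ g : α → ℝ, TendstoInMeasure m
      (fun (n : ℕ) x => (∑ k ∈ Finset.range n, (T^[k] ⁻¹' F).indicator (1 : α → ℝ) x) / (n : ℝ))
      atTop g := by
  set U : Lp ℝ 2 m →L[ℝ] Lp ℝ 2 m :=
    (Lp.compMeasurePreservingₗᵢ ℝ T hT).toContinuousLinearMap with hU
  set x : Lp ℝ 2 m := indicatorConstLp 2 hF (measure_ne_top m F) (1 : ℝ) with hx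
  have hiter : ∀ k, U^[k] x =
      indicatorConstLp 2 (hT.measurable.iterate k hF) (measure_ne_top m _) (1 : ℝ) := by
    intro k
    induction k with
    | zero => rfl
    | succ k ih =>
      rw [Function.iterate_succ_apply', ih]
      rfl
  have hlim := tendstoInMeasure_of_tendsto_Lp
    (U.tendsto_birkhoffAverage_orthogonalProjection
      (LinearIsometry.norm_toContinuousLinearMap_le _) x)
  refine ⟨_, hlim.congr_left fun n => ?_⟩
  simp only [birkhoffAverage, birkhoffSum, id_eq]
  have hk : ∀ᵐ y ∂m, ∀ k, (U^[k] x : Lp ℝ 2 m) y = (T^[k] ⁻¹' F).indicator (1 : α → ℝ) y := by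
    refine ae_all_iff.2 fun k => ?_
    rw [hiter]
    exact indicatorConstLp_coeFn
  filter_upwards [Lp.coeFn_smul ((n : ℝ)⁻¹) (∑ k ∈ Finset.range n, U^[k] x),
    Lp.coeFn_finsetSum (Finset.range n) (fun k => U^[k] x), hk] with y h1 h2 h3
  rw [h1, Pi.smul_apply, h2]
  simp [h3, div_eq_inv_mul]

/-- A finite measure dominated by a stationary finite measure is AMS. -/
lemma Stationary.isAMS_of_absolutelyContinuous (hT : Measurable T) {η m : Measure α}
    [IsFiniteMeasure η] [IsFiniteMeasure m] (hm : Stationary T m) (hac : η ≪ m) :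
    IsAMS T η := by
  intro F hF
  obtain ⟨g, hg⟩ := (hm.measurePreserving hT).exists_tendstoInMeasure_average_indicator hF
  set φ : ℕ → α → ℝ := fun n x =>
    (∑ k ∈ Finset.range n, (T^[k] ⁻¹' F).indicator (1 : α → ℝ) x) / (n : ℝ) with hφ
  have hmeas : ∀ n, Measurable (φ n) := fun n =>
    (Finset.measurable_fun_sum _ fun k _ =>
      measurable_one.indicator (hT.iterate k hF)).div_const _
  have hbound : ∀ n x, ‖φ n x‖ ≤ 1 := by
    intro n x
    rw [hφ, norm_div, Real.norm_natCast]
    refine div_le_one_of_le₀ ?_ n.cast_nonneg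
    refine (norm_sum_le_of_le _ (n := fun _ => (1 : ℝ)) fun k _ => ?_).trans (by simp)
    by_cases hx : x ∈ T^[k] ⁻¹' F <;> simp [Set.indicator, hx]
  have hint : ∀ n : ℕ,
      ∫ x, φ n x ∂η = (∑ k ∈ Finset.range n, (η (T^[k] ⁻¹' F)).toReal) / (n : ℝ) := by
    intro n
    simp only [hφ]
    rw [integral_div, integral_finsetSum (f := fun k => (T^[k] ⁻¹' F).indicator (1 : α → ℝ)) _
      fun k _ => (integrable_const (1 : ℝ)).indicator (hT.iterate k hF)]
    congr 1
    exact Finset.sum_congr rfl fun k _ => integral_indicator_one (hT.iterate k hF)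
  refine ⟨∫ x, g x ∂η, Tendsto.congr hint (tendsto_of_subseq_tendsto fun ns hns => ?_)⟩
  obtain ⟨ms, -, hms⟩ := (hg.comp hns).exists_seq_tendsto_ae
  exact ⟨ms, tendsto_integral_of_dominated_convergence (fun _ => 1)
    (fun n => (hmeas _).aestronglyMeasurable) (integrable_const _)
    (fun n => Eventually.of_forall (hbound _)) (hac.ae_le hms)⟩

end Shift

theorem stmt2 {A B : Type*} [MeasurableSpace A] [MeasurableSpace B]
    (TA : A → A) (TB : B → B) (hTA : Measurable TA) (hTB : Measurable TB)
    (ν : Kernel A B) [IsMarkovKernel ν]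
    (hqs : ∀ (η : Measure A) [IsProbabilityMeasure η], Stationary TA η →
      Stationary (Prod.map TA TB) (η ⊗ₘ ν))
    (μ : Measure A) [IsProbabilityMeasure μ]
    (hrec : Recurrent TA μ) (hams : IsAMS TA μ) :
    Recurrent (Prod.map TA TB) (μ ⊗ₘ ν) ∧ IsAMS (Prod.map TA TB) (μ ⊗ₘ ν) := by
  obtain ⟨m, _, hm, hmean⟩ := hams.exists_isStationaryMean hTA
  have hac : μ ⊗ₘ ν ≪ m ⊗ₘ ν :=
    (hrec.absolutelyContinuous hTA hm hmean).compProd_left ν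
  have hT : Measurable (Prod.map TA TB) := hTA.prodMap hTB
  exact ⟨(hqs m hm).recurrent_of_absolutelyContinuous hT hac,
    (hqs m hm).isAMS_of_absolutelyContinuous hT hac⟩
end

section
/- Let μ be a probability measure on A that is stationary under T_A, let ν be a channel from A to B such that the hookup μν is recurrent and AMS under T_{AB}, and let ν̄_μ be a channel from A to B whose hookup μν̄_μ equals the stationary mean of μν. For each i ≥ 0 let ν_i be a channel from A to B satisfying μν_i = (μν) ∘ T_{AB}^{-i}. Then for every measurable G ⊆ B, ν̄_μ(x,G) = lim_{n→∞} (1/n) Σ_{i=0}^{n-1} ν_i(x,G) for μ-almost every x. -/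
open MeasureTheory ProbabilityTheory Filter

/-- `P` is the transfer (Perron–Frobenius) operator of `T` on `L¹(m)`. -/
def IsTransferOp {X : Type*} [MeasurableSpace X] {m : Measure X} (T : X → X)
    (P : Lp ℝ 1 m →ₗ[ℝ] Lp ℝ 1 m) : Prop :=
  ∀ (u : Lp ℝ 1 m) (F : Set X), MeasurableSet F →
    ∫ x in F, P u x ∂m = ∫ x in T ⁻¹' F, u x ∂m

section Transfer

variable {X : Type*} [MeasurableSpace X] {m : Measure X} {T : X → X}
  {P : Lp ℝ 1 m →ₗ[ℝ] Lp ℝ 1 m}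

lemma L1_le_of_forall_setIntegral_le {u v : Lp ℝ 1 m}
    (h : ∀ F : Set X, MeasurableSet F → ∫ x in F, u x ∂m ≤ ∫ x in F, v x ∂m) : u ≤ v := by
  rw [← Lp.coeFn_le]
  exact ae_le_of_forall_setIntegral_le (L1.integrable_coeFn u) (L1.integrable_coeFn v)
    fun F hF _ => h F hF

lemma L1_ext_of_forall_setIntegral {u v : Lp ℝ 1 m}
    (h : ∀ F : Set X, MeasurableSet F → ∫ x in F, u x ∂m = ∫ x in F, v x ∂m) : u = v :=
  le_antisymm (L1_le_of_forall_setIntegral_le fun F hF => (h F hF).le)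
    (L1_le_of_forall_setIntegral_le fun F hF => (h F hF).ge)

lemma L1_setIntegral_add (u v : Lp ℝ 1 m) (F : Set X) :
    ∫ x in F, (u + v : Lp ℝ 1 m) x ∂m = ∫ x in F, u x ∂m + ∫ x in F, v x ∂m := by
  rw [← integral_add (L1.integrable_coeFn u).integrableOn (L1.integrable_coeFn v).integrableOn]
  exact integral_congr_ae (ae_restrict_of_ae (Lp.coeFn_add u v))

lemma L1_setIntegral_smul (c : ℝ) (u : Lp ℝ 1 m) (F : Set X) :
    ∫ x in F, (c • u : Lp ℝ 1 m) x ∂m = c * ∫ x in F, u x ∂m := by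
  rw [← integral_const_mul]
  exact integral_congr_ae (ae_restrict_of_ae (Lp.coeFn_smul c u))

lemma L1_setIntegral_sub (u v : Lp ℝ 1 m) (F : Set X) :
    ∫ x in F, (u - v : Lp ℝ 1 m) x ∂m = ∫ x in F, u x ∂m - ∫ x in F, v x ∂m := by
  rw [← integral_sub (L1.integrable_coeFn u).integrableOn (L1.integrable_coeFn v).integrableOn]
  exact integral_congr_ae (ae_restrict_of_ae (Lp.coeFn_sub u v))

lemma L1_setIntegral_mono {u v : Lp ℝ 1 m} (h : u ≤ v) (F : Set X) :
    ∫ x in F, u x ∂m ≤ ∫ x in F, v x ∂m :=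
  integral_mono_ae (L1.integrable_coeFn u).integrableOn (L1.integrable_coeFn v).integrableOn
    (ae_restrict_of_ae ((Lp.coeFn_le u v).2 h))

lemma IsTransferOp.mono (hP : IsTransferOp T P) {u v : Lp ℝ 1 m} (h : u ≤ v) : P u ≤ P v :=
  L1_le_of_forall_setIntegral_le fun F hF => by
    rw [hP u F hF, hP v F hF]; exact L1_setIntegral_mono h _

lemma IsTransferOp.integral_eq (hP : IsTransferOp T P) (u : Lp ℝ 1 m) :
    ∫ x, P u x ∂m = ∫ x, u x ∂m := by
  simpa using hP u Set.univ MeasurableSet.univ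

lemma IsTransferOp.setIntegral_pow (hTm : Measurable T) (hP : IsTransferOp T P) (u : Lp ℝ 1 m)
    (k : ℕ) {F : Set X} (hF : MeasurableSet F) :
    ∫ x in F, (P ^ k) u x ∂m = ∫ x in T^[k] ⁻¹' F, u x ∂m := by
  induction k generalizing u with
  | zero => simp
  | succ k ih =>
    rw [pow_succ, Module.End.mul_apply, ih (P u), hP u _ ((hTm.iterate k) hF),
      ← Set.preimage_comp, Function.iterate_succ]

lemma IsTransferOp.pow_mono (hP : IsTransferOp T P) (k : ℕ) {u v : Lp ℝ 1 m} (h : u ≤ v) :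
    (P ^ k) u ≤ (P ^ k) v := by
  induction k generalizing u v with
  | zero => simpa using h
  | succ k ih => rw [pow_succ]; exact ih (hP.mono h)

/-- Positive parts of the running maxima of the partial sums `q + P q + ⋯ + P ^ k q`. -/
noncomputable def hopfMax (P : Lp ℝ 1 m →ₗ[ℝ] Lp ℝ 1 m) (q : Lp ℝ 1 m) : ℕ → Lp ℝ 1 m
  | 0 => 0
  | n + 1 => (q + P (hopfMax P q n)) ⊔ 0

lemma hopfMax_nonneg (q : Lp ℝ 1 m) (n : ℕ) : 0 ≤ hopfMax P q n := by
  cases n with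
  | zero => exact le_rfl
  | succ n => exact le_sup_right

lemma hopfMax_mono (hP : IsTransferOp T P) (q : Lp ℝ 1 m) : Monotone (hopfMax P q) := by
  refine monotone_nat_of_le_succ fun n => ?_
  induction n with
  | zero => exact hopfMax_nonneg q _
  | succ n ih => exact sup_le_sup_right (add_le_add_right (hP.mono ih) q) 0

lemma sum_pow_le_hopfMax (hP : IsTransferOp T P) (q : Lp ℝ 1 m) (n : ℕ) :
    ∑ k ∈ Finset.range n, (P ^ k) q ≤ hopfMax P q n := by
  induction n with
  | zero => exact (Finset.sum_range_zero _).le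
  | succ n ih =>
    have h : ∑ k ∈ Finset.range (n + 1), (P ^ k) q
        = q + P (∑ k ∈ Finset.range n, (P ^ k) q) := by
      rw [Finset.sum_range_succ', map_sum, add_comm]
      simp [pow_succ']
    rw [h]
    exact (add_le_add_right (hP.mono ih) q).trans le_sup_left

/-- **Hopf's maximal ergodic lemma**. -/
lemma setIntegral_hopfMax_pos_nonneg (hP : IsTransferOp T P) (q : Lp ℝ 1 m) (n : ℕ) :
    0 ≤ ∫ x in {x | 0 < hopfMax P q n x}, q x ∂m := by
  cases n with
  | zero =>
    rw [setIntegral_measure_zero]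
    have h0 : hopfMax P q 0 =ᵐ[m] 0 := Lp.coeFn_zero ℝ 1 m
    have h1 : ∀ᵐ x ∂m, ¬ (0 < hopfMax P q 0 x) := by
      filter_upwards [h0] with x hx
      rw [hx]; exact lt_irrefl _
    simpa [ae_iff] using h1
  | succ n =>
    set E : Set X := {x | 0 < hopfMax P q (n + 1) x} with hE
    have hEm : MeasurableSet E :=
      measurableSet_lt measurable_const (Lp.stronglyMeasurable _).measurable
    have hint : ∀ u : Lp ℝ 1 m, IntegrableOn u E m := fun u => (L1.integrable_coeFn u).integrableOn
    have h0 : ∫ x in E, hopfMax P q (n + 1) x ∂m = ∫ x, hopfMax P q (n + 1) x ∂m := by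
      refine setIntegral_eq_integral_of_ae_compl_eq_zero ?_
      filter_upwards [(Lp.coeFn_nonneg _).2 (hopfMax_nonneg (P := P) q (n + 1))] with x hx hxE
      exact le_antisymm (not_lt.1 hxE) hx
    have h1 : ∫ x in E, hopfMax P q (n + 1) x ∂m
        ≤ ∫ x in E, (q + P (hopfMax P q n) : Lp ℝ 1 m) x ∂m := by
      refine setIntegral_mono_on_ae (hint _) (hint _) hEm ?_
      filter_upwards [Lp.coeFn_sup (q + P (hopfMax P q n)) 0, Lp.coeFn_zero ℝ 1 m]
        with x hx hx0 hxE
      change hopfMax P q (n + 1) x = _ at hx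
      rw [Pi.sup_apply, hx0, Pi.zero_apply] at hx
      have : 0 < hopfMax P q (n + 1) x := hxE
      rw [hx] at this ⊢
      rcases lt_sup_iff.1 this with h | h
      · exact (sup_of_le_left h.le).le
      · exact absurd h (lt_irrefl _)
    have h2 : ∫ x in E, P (hopfMax P q n) x ∂m ≤ ∫ x, P (hopfMax P q n) x ∂m := by
      refine setIntegral_le_integral (L1.integrable_coeFn _) ?_
      refine (Lp.coeFn_nonneg _).2 ?_
      simpa using hP.mono (hopfMax_nonneg (P := P) q n)
    have h3 : ∫ x, hopfMax P q n x ∂m ≤ ∫ x, hopfMax P q (n + 1) x ∂m := by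
      simpa using L1_setIntegral_mono (hopfMax_mono hP q n.le_succ) Set.univ
    rw [L1_setIntegral_add] at h1
    rw [hP.integral_eq] at h2
    linarith

lemma sub_average_eq_coboundary (P : Lp ℝ 1 m →ₗ[ℝ] Lp ℝ 1 m) (g : Lp ℝ 1 m) {N : ℕ}
    (hN : N ≠ 0) :
    g - (N : ℝ)⁻¹ • ∑ k ∈ Finset.range N, (P ^ k) g
      = (N : ℝ)⁻¹ • (∑ k ∈ Finset.range N, ∑ j ∈ Finset.range k, (P ^ j) g)
        - P ((N : ℝ)⁻¹ • (∑ k ∈ Finset.range N, ∑ j ∈ Finset.range k, (P ^ j) g)) := by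
  have h : ∀ k, ∑ j ∈ Finset.range k, (P ^ j) g - P (∑ j ∈ Finset.range k, (P ^ j) g)
      = g - (P ^ k) g := by
    intro k
    rw [map_sum, ← Finset.sum_sub_distrib]
    simp_rw [← Module.End.mul_apply, ← pow_succ']
    simpa using Finset.sum_range_sub' (fun j => (P ^ j) g) k
  rw [map_smul, ← smul_sub, map_sum, ← Finset.sum_sub_distrib, Finset.sum_congr rfl fun k _ => h k,
    Finset.sum_sub_distrib, smul_sub, Finset.sum_const, Finset.card_range,
    ← Nat.cast_smul_eq_nsmul ℝ, smul_smul, inv_mul_cancel₀ (by exact_mod_cast hN), one_smul]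

lemma L1_setIntegral_sum {ι : Type*} (s : Finset ι) (u : ι → Lp ℝ 1 m) (F : Set X) :
    ∫ x in F, (∑ i ∈ s, u i : Lp ℝ 1 m) x ∂m = ∑ i ∈ s, ∫ x in F, u i x ∂m := by
  classical
  induction s using Finset.induction_on with
  | empty =>
    simp only [Finset.sum_empty]
    rw [integral_congr_ae (ae_restrict_of_ae (Lp.coeFn_zero ℝ 1 m))]
    simp
  | insert i s hi ih => rw [Finset.sum_insert hi, Finset.sum_insert hi, L1_setIntegral_add, ih]

lemma L1_norm_eq_integral_of_nonneg {u : Lp ℝ 1 m} (hu : 0 ≤ u) : ‖u‖ = ∫ x, u x ∂m := by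
  rw [L1.norm_eq_integral_norm]
  refine integral_congr_ae ?_
  filter_upwards [(Lp.coeFn_nonneg _).2 hu] with x hx
  exact Real.norm_of_nonneg hx

lemma setIntegral_average (P : Lp ℝ 1 m →ₗ[ℝ] Lp ℝ 1 m) (u : Lp ℝ 1 m) (n : ℕ) (F : Set X) :
    ∫ x in F, ((n : ℝ)⁻¹ • ∑ k ∈ Finset.range n, (P ^ k) u : Lp ℝ 1 m) x ∂m
      = (∑ k ∈ Finset.range n, ∫ x in F, (P ^ k) u x ∂m) / n := by
  rw [L1_setIntegral_smul, L1_setIntegral_sum, inv_mul_eq_div]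

lemma IsTransferOp.integral_pow_eq (hP : IsTransferOp T P) (u : Lp ℝ 1 m) (k : ℕ) :
    ∫ x, (P ^ k) u x ∂m = ∫ x, u x ∂m := by
  induction k with
  | zero => simp
  | succ k ih => rw [pow_succ', Module.End.mul_apply, hP.integral_eq, ih]

lemma IsTransferOp.integral_average_eq (hP : IsTransferOp T P) (u : Lp ℝ 1 m) {n : ℕ}
    (hn : n ≠ 0) :
    ∫ x, ((n : ℝ)⁻¹ • ∑ k ∈ Finset.range n, (P ^ k) u : Lp ℝ 1 m) x ∂m = ∫ x, u x ∂m := by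
  have h := setIntegral_average P u n Set.univ
  simp only [setIntegral_univ, hP.integral_pow_eq, Finset.sum_const, Finset.card_range,
    nsmul_eq_mul] at h
  rw [h, mul_div_cancel_left₀ _ (by exact_mod_cast hn)]

lemma L1_coeFn_sum {ι : Type*} (s : Finset ι) (u : ι → Lp ℝ 1 m) :
    ∀ᵐ x ∂m, (∑ i ∈ s, u i : Lp ℝ 1 m) x = ∑ i ∈ s, u i x := by
  filter_upwards [Lp.coeFn_finsetSum s u] with x hx
  rw [hx, Finset.sum_apply]

variable [IsProbabilityMeasure m]

lemma exists_L1_setIntegral_preimage (hT : MeasurePreserving T m m) (u : Lp ℝ 1 m) :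
    ∃ v : Lp ℝ 1 m, ∀ F : Set X, MeasurableSet F →
      ∫ x in F, v x ∂m = ∫ x in T ⁻¹' F, u x ∂m := by
  set s : SignedMeasure X := (m.withDensityᵥ u).map T with hs
  have hu := L1.integrable_coeFn u
  have hac : s ≪ᵥ m.toENNRealVectorMeasure := by
    refine VectorMeasure.AbsolutelyContinuous.mk fun F hF hF0 => ?_
    rw [Measure.toENNRealVectorMeasure_apply_measurable hF] at hF0
    rw [hs, VectorMeasure.map_apply _ hT.measurable hF,
      withDensityᵥ_apply hu (hT.measurable hF)]
    exact setIntegral_measure_zero _ (by rw [hT.measure_preimage hF.nullMeasurableSet, hF0])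
  have hi := SignedMeasure.integrable_rnDeriv s m
  refine ⟨hi.toL1 _, fun F hF => ?_⟩
  rw [← withDensityᵥ_apply hu (hT.measurable hF), ← VectorMeasure.map_apply _ hT.measurable hF,
    ← hs]
  refine Eq.trans ?_ (congrArg (fun v : SignedMeasure X => v F)
    (SignedMeasure.withDensityᵥ_rnDeriv_eq s m hac))
  rw [withDensityᵥ_apply hi hF]
  exact integral_congr_ae (ae_restrict_of_ae hi.coeFn_toL1)

lemma exists_isTransferOp (hT : MeasurePreserving T m m) :
    ∃ P : Lp ℝ 1 m →ₗ[ℝ] Lp ℝ 1 m, IsTransferOp T P := by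
  choose P hP using exists_L1_setIntegral_preimage (m := m) hT
  refine ⟨⟨⟨P, fun u v => ?_⟩, fun c u => ?_⟩, hP⟩
  · refine L1_ext_of_forall_setIntegral fun F hF => ?_
    rw [hP _ F hF, L1_setIntegral_add, L1_setIntegral_add, hP _ F hF, hP _ F hF]
  · refine L1_ext_of_forall_setIntegral fun F hF => ?_
    rw [hP _ F hF, L1_setIntegral_smul, RingHom.id_apply, L1_setIntegral_smul, hP _ F hF]

lemma IsTransferOp.map_const (hT : MeasurePreserving T m m) (hP : IsTransferOp T P) (c : ℝ) :
    P (Lp.const 1 m c) = Lp.const 1 m c := by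
  refine L1_ext_of_forall_setIntegral fun F hF => ?_
  rw [hP _ F hF, integral_congr_ae (ae_restrict_of_ae (Lp.coeFn_const (p := 1) (μ := m) c)),
    integral_congr_ae (ae_restrict_of_ae (Lp.coeFn_const (p := 1) (μ := m) c))]
  simp [measureReal_def, hT.measure_preimage hF.nullMeasurableSet]

lemma IsTransferOp.pow_const (hT : MeasurePreserving T m m) (hP : IsTransferOp T P) (k : ℕ)
    (c : ℝ) : (P ^ k) (Lp.const 1 m c) = Lp.const 1 m c := by
  induction k with
  | zero => simp
  | succ k ih => rw [pow_succ, Module.End.mul_apply, hP.map_const hT, ih]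

/-- The weak-type maximal inequality for Cesàro averages of the transfer operator. -/
lemma maximal_inequality (hT : MeasurePreserving T m m) (hP : IsTransferOp T P) {r : Lp ℝ 1 m}
    (hr : 0 ≤ r) {c : ℝ} (hc : 0 < c) :
    m {x | ∃ n : ℕ, n * c < (∑ k ∈ Finset.range n, (P ^ k) r : Lp ℝ 1 m) x}
      ≤ ENNReal.ofReal ((∫ x, r x ∂m) / c) := by
  set D : ℕ → Set X := fun N =>
    {x | ∃ n ≤ N, n * c < (∑ k ∈ Finset.range n, (P ^ k) r : Lp ℝ 1 m) x} with hD
  have hDmono : Monotone D := fun N N' h x ⟨n, hn, hx⟩ => ⟨n, hn.trans h, hx⟩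
  have hU : {x | ∃ n : ℕ, n * c < (∑ k ∈ Finset.range n, (P ^ k) r : Lp ℝ 1 m) x} = ⋃ N, D N := by
    ext x
    simp only [Set.mem_ofPred_eq, Set.mem_iUnion, hD]
    exact ⟨fun ⟨n, h⟩ => ⟨n, n, le_rfl, h⟩, fun ⟨_, n, _, h⟩ => ⟨n, h⟩⟩
  rw [hU, hDmono.measure_iUnion]
  refine iSup_le fun N => ?_
  set q : Lp ℝ 1 m := r - Lp.const 1 m c with hq
  set E : Set X := {x | 0 < hopfMax P q N x} with hE
  have hEm : MeasurableSet E :=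
    measurableSet_lt measurable_const (Lp.stronglyMeasurable _).measurable
  have hDE : D N ≤ᵐ[m] E := by
    have h1 : ∀ n, ∀ᵐ x ∂m, n ≤ N →
        (∑ k ∈ Finset.range n, (P ^ k) r : Lp ℝ 1 m) x - n * c ≤ hopfMax P q N x := by
      intro n
      by_cases hn : n ≤ N
      · have h2 : ∑ k ∈ Finset.range n, (P ^ k) r - Lp.const 1 m (n * c) ≤ hopfMax P q N := by
          refine le_trans (le_of_eq ?_) ((sum_pow_le_hopfMax hP q n).trans (hopfMax_mono hP q hn))
          have h3 : Lp.const 1 m ((n : ℝ) * c) = (n : ℝ) • Lp.const 1 m c := by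
            rw [← smul_eq_mul]; exact map_smul (Lp.constₗ 1 m ℝ) (n : ℝ) c
          simp only [hq, map_sub, hP.pow_const hT, Finset.sum_sub_distrib, Finset.sum_const,
            Finset.card_range, h3, Nat.cast_smul_eq_nsmul]
        filter_upwards [(Lp.coeFn_le _ _).2 h2, Lp.coeFn_sub (∑ k ∈ Finset.range n, (P ^ k) r)
          (Lp.const 1 m (n * c)), Lp.coeFn_const (p := 1) (μ := m) ((n : ℝ) * c)]
          with x hx1 hx2 hx3 _
        rw [hx2, Pi.sub_apply, hx3] at hx1
        exact hx1
      · exact Eventually.of_forall fun x h => absurd h hn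
    filter_upwards [ae_all_iff.2 h1] with x hx ⟨n, hn, hxn⟩
    have := hx n hn
    change 0 < hopfMax P q N x
    linarith
  refine (measure_mono_ae hDE).trans ?_
  rw [← ENNReal.ofReal_toReal (measure_ne_top m E)]
  refine ENNReal.ofReal_le_ofReal ?_
  rw [le_div_iff₀ hc]
  have h1 := setIntegral_hopfMax_pos_nonneg hP q N
  rw [← hE, hq, L1_setIntegral_sub,
    integral_congr_ae (ae_restrict_of_ae (Lp.coeFn_const (p := 1) (μ := m) c))] at h1
  have h2 : ∫ x in E, r x ∂m ≤ ∫ x, r x ∂m :=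
    setIntegral_le_integral (L1.integrable_coeFn _) ((Lp.coeFn_nonneg _).2 hr)
  simp [measureReal_def] at h1
  linarith

/-- The inclusion of `L²` into `L¹` for a probability measure. -/
noncomputable def inclL2L1 (m : Measure X) [IsProbabilityMeasure m] : Lp ℝ 2 m →ₗ[ℝ] Lp ℝ 1 m where
  toFun := AddSubgroup.inclusion (Lp.antitone one_le_two)
  map_add' _ _ := rfl
  map_smul' _ _ := rfl

lemma norm_inclL2L1_le (u : Lp ℝ 2 m) : ‖inclL2L1 m u‖ ≤ ‖u‖ := by
  rw [Lp.norm_def, Lp.norm_def]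
  exact ENNReal.toReal_mono (Lp.eLpNorm_ne_top u)
    (eLpNorm_le_eLpNorm_of_exponent_le one_le_two (Lp.aestronglyMeasurable u))

/-- The mean ergodic theorem for the transfer operator on square integrable functions. -/
lemma exists_tendsto_average_transfer (hT : MeasurePreserving T m m) (hP : IsTransferOp T P)
    (g : Lp ℝ 2 m) : ∃ gs : Lp ℝ 1 m,
      Tendsto (fun n : ℕ => (n : ℝ)⁻¹ • ∑ k ∈ Finset.range n, (P ^ k) (inclL2L1 m g))
        atTop (nhds gs) := by
  set U : Lp ℝ 2 m →L[ℝ] Lp ℝ 2 m :=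
    (Lp.compMeasurePreservingₗᵢ ℝ T hT).toContinuousLinearMap with hU
  set Q : Lp ℝ 2 m →L[ℝ] Lp ℝ 2 m := ContinuousLinearMap.adjoint U with hQ
  have hQn : ‖Q‖ ≤ 1 := by
    rw [hQ, LinearIsometryEquiv.norm_map]
    exact LinearIsometry.norm_toContinuousLinearMap_le _
  have hcomm : ∀ u, P (inclL2L1 m u) = inclL2L1 m (Q u) := by
    intro u
    refine L1_ext_of_forall_setIntegral fun F hF => ?_
    rw [hP _ F hF]
    change ∫ x in T ⁻¹' F, u x ∂m = ∫ x in F, Q u x ∂m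
    rw [← L2.inner_indicatorConstLp_one (𝕜 := ℝ) hF (measure_ne_top m F),
      ← L2.inner_indicatorConstLp_one (𝕜 := ℝ) (hT.measurable hF) (measure_ne_top m _),
      hQ, ContinuousLinearMap.adjoint_inner_right]
    congr 1
  have hiter : ∀ k u, (P ^ k) (inclL2L1 m u) = inclL2L1 m (Q^[k] u) := by
    intro k
    induction k with
    | zero => intro u; simp
    | succ k ih => intro u; rw [pow_succ, Module.End.mul_apply, hcomm, ih, Function.iterate_succ_apply]
  have hcont : Continuous (inclL2L1 m) :=
    AddMonoidHomClass.continuous_of_bound (inclL2L1 m) 1 fun u => by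
      simpa using norm_inclL2L1_le u
  have h := Q.tendsto_birkhoffAverage_orthogonalProjection hQn g
  refine ⟨_, ((hcont.tendsto _).comp h).congr fun n => ?_⟩
  simp [birkhoffAverage, birkhoffSum, hiter]

lemma L1_setIntegral_const (c : ℝ) (F : Set X) :
    ∫ x in F, (Lp.const 1 m c) x ∂m = m.real F * c := by
  rw [integral_congr_ae (ae_restrict_of_ae (Lp.coeFn_const (p := 1) (μ := m) c))]
  simp

/-- Truncation of a nonnegative `L¹` function by a bounded one. -/
lemma exists_truncation {f : Lp ℝ 1 m} (hf : 0 ≤ f) {ε : ℝ} (hε : 0 < ε) :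
    ∃ (g : Lp ℝ 2 m) (C : ℝ), 0 ≤ C ∧ 0 ≤ inclL2L1 m g ∧ inclL2L1 m g ≤ Lp.const 1 m C ∧
      inclL2L1 m g ≤ f ∧ ‖f - inclL2L1 m g‖ ≤ ε := by
  have hfi := L1.integrable_coeFn f
  have hf0 : ∀ᵐ x ∂m, 0 ≤ f x := (Lp.coeFn_nonneg _).2 hf
  have hmeas : ∀ N : ℕ, AEStronglyMeasurable (fun x => min (f x) (N : ℝ)) m := fun N =>
    (hfi.aestronglyMeasurable.inf aestronglyMeasurable_const)
  have hlim : Tendsto (fun N : ℕ => ∫ x, min (f x) (N : ℝ) ∂m) atTop (nhds (∫ x, f x ∂m)) := by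
    refine tendsto_integral_of_dominated_convergence (fun x => ‖f x‖) hmeas hfi.norm ?_ ?_
    · intro N
      filter_upwards [hf0] with x hx
      rw [Real.norm_of_nonneg (le_min hx N.cast_nonneg), Real.norm_of_nonneg hx]
      exact min_le_left _ _
    · refine Eventually.of_forall fun x => ?_
      obtain ⟨K, hK⟩ := exists_nat_ge (f x)
      refine tendsto_const_nhds.congr' ?_
      filter_upwards [eventually_ge_atTop K] with N hN
      exact (min_eq_left (hK.trans (by exact_mod_cast hN))).symm
  obtain ⟨N, hN⟩ := (hlim.eventually (lt_mem_nhds (sub_lt_self _ hε))).exists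
  have hg : MemLp (fun x => min (f x) (N : ℝ)) 2 m := by
    refine MemLp.of_bound (hmeas N) N ?_
    filter_upwards [hf0] with x hx
    rw [Real.norm_of_nonneg (le_min hx N.cast_nonneg)]
    exact min_le_right _ _
  have hcoe : ∀ᵐ x ∂m, inclL2L1 m (hg.toLp _) x = min (f x) (N : ℝ) := hg.coeFn_toLp
  have hle : inclL2L1 m (hg.toLp _) ≤ f := by
    rw [← Lp.coeFn_le]
    filter_upwards [hcoe] with x hx
    rw [hx]; exact min_le_left _ _
  refine ⟨hg.toLp _, N, N.cast_nonneg, ?_, ?_, hle, ?_⟩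
  · rw [← Lp.coeFn_nonneg]
    filter_upwards [hcoe, hf0] with x hx hx0
    rw [hx]; exact le_min hx0 N.cast_nonneg
  · rw [← Lp.coeFn_le]
    filter_upwards [hcoe, Lp.coeFn_const (p := 1) (μ := m) (N : ℝ)] with x hx hx1
    rw [hx, hx1]; exact min_le_right _ _
  · rw [L1_norm_eq_integral_of_nonneg (sub_nonneg.2 hle)]
    have := L1_setIntegral_sub f (inclL2L1 m (hg.toLp _)) Set.univ
    simp only [setIntegral_univ] at this
    rw [this, integral_congr_ae hcoe]
    linarith

/-- Up to a small error in `L¹`, the function `f - 1` is a coboundary of a bounded function. -/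
lemma exists_coboundary_approx (hT : MeasurePreserving T m m) (hP : IsTransferOp T P)
    {f : Lp ℝ 1 m} (hf : 0 ≤ f)
    (hlim : ∀ F : Set X, MeasurableSet F →
      Tendsto (fun n : ℕ => (∑ k ∈ Finset.range n, ∫ x in F, (P ^ k) f x ∂m) / n)
        atTop (nhds (m.real F)))
    {ε : ℝ} (hε : 0 < ε) :
    ∃ (h r : Lp ℝ 1 m) (C : ℝ), |h| ≤ Lp.const 1 m C ∧
      f - Lp.const 1 m 1 = (h - P h) + r ∧ ‖r‖ ≤ ε := by
  obtain ⟨g₂, C, hC, hg0, hgC, hgf, hfg⟩ := exists_truncation hf (half_pos (half_pos hε))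
  obtain ⟨gs, hgs⟩ := exists_tendsto_average_transfer hT hP g₂
  set g := inclL2L1 m g₂ with hg
  have hset : ∀ F : Set X, Tendsto
      (fun n : ℕ => (∑ k ∈ Finset.range n, ∫ x in F, (P ^ k) g x ∂m) / n)
      atTop (nhds (∫ x in F, gs x ∂m)) := fun F =>
    (((continuous_setIntegral (E := ℝ) (μ := m) F).tendsto gs).comp hgs).congr fun n =>
      setIntegral_average P g n F
  have hgs1 : gs ≤ Lp.const 1 m 1 := by
    refine L1_le_of_forall_setIntegral_le fun F hF => ?_
    rw [L1_setIntegral_const, mul_one]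
    refine le_of_tendsto_of_tendsto' (hset F) (hlim F hF) fun n => ?_
    exact div_le_div_of_nonneg_right (Finset.sum_le_sum fun k _ =>
      L1_setIntegral_mono (hP.pow_mono k hgf) F) n.cast_nonneg
  have hgsint : ∫ x, gs x ∂m = ∫ x, g x ∂m := by
    have h := hset Set.univ
    simp only [setIntegral_univ] at h
    refine tendsto_nhds_unique h (tendsto_const_nhds.congr' ?_)
    filter_upwards [eventually_ne_atTop 0] with n hn
    rw [← hP.integral_average_eq g hn]
    simpa using setIntegral_average P g n Set.univ
  have hfint : ∫ x, f x ∂m = 1 := by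
    have h := hlim Set.univ MeasurableSet.univ
    simp only [setIntegral_univ, probReal_univ] at h
    refine tendsto_nhds_unique (tendsto_const_nhds.congr' ?_) h
    filter_upwards [eventually_ne_atTop 0] with n hn
    rw [← hP.integral_average_eq f hn]
    simpa using setIntegral_average P f n Set.univ
  have hgsn : ‖gs - Lp.const 1 m 1‖ ≤ ε / 2 / 2 := by
    refine le_trans (le_of_eq ?_) hfg
    rw [norm_sub_rev, L1_norm_eq_integral_of_nonneg (sub_nonneg.2 hgs1),
      L1_norm_eq_integral_of_nonneg (sub_nonneg.2 hgf)]
    have h1 := L1_setIntegral_sub f g Set.univ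
    have h2 := L1_setIntegral_sub (Lp.const 1 m 1) gs Set.univ
    rw [L1_setIntegral_const] at h2
    simp only [setIntegral_univ, probReal_univ] at h1 h2
    rw [h1, h2, hgsint, hfint, mul_one]
  have hev : ∀ᶠ n : ℕ in atTop,
      ‖(n : ℝ)⁻¹ • ∑ k ∈ Finset.range n, (P ^ k) g - gs‖ < ε / 2 := by
    have := (tendsto_iff_norm_sub_tendsto_zero.1 hgs)
    exact this.eventually (gt_mem_nhds (half_pos hε))
  obtain ⟨N, hN, hN0⟩ := (hev.and (eventually_ne_atTop 0)).exists
  set A := (N : ℝ)⁻¹ • ∑ k ∈ Finset.range N, (P ^ k) g with hA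
  set H := ∑ k ∈ Finset.range N, ∑ j ∈ Finset.range k, (P ^ j) g with hH
  refine ⟨(N : ℝ)⁻¹ • H, (A - gs) + (gs - Lp.const 1 m 1) + (f - g), (N : ℝ)⁻¹ *
    (∑ k ∈ Finset.range N, ∑ j ∈ Finset.range k, C), ?_, ?_, ?_⟩
  · have hPg0 : ∀ j, 0 ≤ (P ^ j) g := fun j => by simpa using hP.pow_mono j hg0
    have hH0 : 0 ≤ H := Finset.sum_nonneg fun k _ => Finset.sum_nonneg fun j _ => hPg0 j
    have hHC : H ≤ Lp.const 1 m (∑ k ∈ Finset.range N, ∑ j ∈ Finset.range k, C) := by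
      rw [map_sum]
      refine Finset.sum_le_sum fun k _ => ?_
      rw [map_sum]
      refine Finset.sum_le_sum fun j _ => ?_
      rw [← hP.pow_const hT j C]
      exact hP.pow_mono j hgC
    rw [← Lp.coeFn_le]
    filter_upwards [Lp.coeFn_abs ((N : ℝ)⁻¹ • H), Lp.coeFn_smul (N : ℝ)⁻¹ H,
      (Lp.coeFn_nonneg _).2 hH0, (Lp.coeFn_le _ _).2 hHC,
      Lp.coeFn_const (p := 1) (μ := m) (∑ k ∈ Finset.range N, ∑ j ∈ Finset.range k, C),
      Lp.coeFn_const (p := 1) (μ := m)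
        ((N : ℝ)⁻¹ * ∑ k ∈ Finset.range N, ∑ j ∈ Finset.range k, C)] with x h1 h2 h3 h4 h5 h6
    have hNi : (0 : ℝ) ≤ (N : ℝ)⁻¹ := by positivity
    have h3' : 0 ≤ H x := h3
    rw [h1, h2, h6, Pi.smul_apply, smul_eq_mul, abs_of_nonneg (mul_nonneg hNi h3')]
    rw [h5] at h4
    exact mul_le_mul_of_nonneg_left h4 hNi
  · rw [← sub_average_eq_coboundary P g hN0, ← hA]
    abel
  · calc ‖(A - gs) + (gs - Lp.const 1 m 1) + (f - g)‖
        ≤ ‖A - gs‖ + ‖gs - Lp.const 1 m 1‖ + ‖f - g‖ := norm_add₃_le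
      _ ≤ ε / 2 + ε / 2 / 2 + ε / 2 / 2 := by gcongr
      _ = ε := by ring

/-- Pointwise convergence of the averages of a transfer operator when they converge to the
constant `1` on every measurable set. -/
theorem ae_tendsto_average_transfer (hT : MeasurePreserving T m m) (hP : IsTransferOp T P)
    {f : Lp ℝ 1 m} (hf : 0 ≤ f)
    (hlim : ∀ F : Set X, MeasurableSet F →
      Tendsto (fun n : ℕ => (∑ k ∈ Finset.range n, ∫ x in F, (P ^ k) f x ∂m) / n)
        atTop (nhds (m.real F))) :
    ∀ᵐ x ∂m, Tendsto (fun n : ℕ => (∑ k ∈ Finset.range n, (P ^ k) f x) / n)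
      atTop (nhds 1) := by
  have key : ∀ c : ℝ, 0 < c → ∀ᵐ x ∂m, ∀ᶠ n : ℕ in atTop,
      |∑ k ∈ Finset.range n, (P ^ k) f x - n| ≤ n * (2 * c) := by
    intro c hc
    rw [ae_iff]
    refine le_antisymm (le_of_forall_pos_le_add fun ε hε => ?_) zero_le
    rw [zero_add]
    rcases eq_or_ne ε ⊤ with rfl | hεt
    · exact le_top
    have hε' : 0 < ε.toReal := ENNReal.toReal_pos hε.ne' hεt
    obtain ⟨h, r, C, hh, hfr, hr⟩ := exists_coboundary_approx hT hP hf hlim (mul_pos hε' hc)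
    have hmax := maximal_inequality hT hP (abs_nonneg r) hc
    have hb : (∫ x, |r| x ∂m) / c ≤ ε.toReal := by
      rw [div_le_iff₀ hc, ← L1_norm_eq_integral_of_nonneg (abs_nonneg r), norm_abs_eq_norm]
      exact hr
    refine le_trans (measure_mono_ae ?_)
      (hmax.trans ((ENNReal.ofReal_le_ofReal hb).trans (ENNReal.ofReal_toReal hεt).le))
    have hdecomp : ∀ n : ℕ, ∑ k ∈ Finset.range n, (P ^ k) f
        = Lp.const 1 m (n : ℝ) + (h - (P ^ n) h) + ∑ k ∈ Finset.range n, (P ^ k) r := by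
      intro n
      have h1 : f = Lp.const 1 m 1 + (h - P h) + r := by
        rw [add_assoc, ← hfr]; abel
      have h2 : ∑ k ∈ Finset.range n, (P ^ k) (h - P h) = h - (P ^ n) h := by
        have := Finset.sum_range_sub' (fun j => (P ^ j) h) n
        simp only [pow_zero, Module.End.one_apply] at this
        rw [← this]
        refine Finset.sum_congr rfl fun k _ => ?_
        rw [map_sub, pow_succ, Module.End.mul_apply]
      have h3 : Lp.const 1 m (n : ℝ) = n • Lp.const 1 m (1 : ℝ) := by
        rw [← map_nsmul, nsmul_one]
      conv_lhs => rw [h1]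
      simp only [map_add, hP.pow_const hT, Finset.sum_add_distrib, h2, h3, Finset.sum_const,
        Finset.card_range]
    have hPh : ∀ n : ℕ, |(P ^ n) h| ≤ Lp.const 1 m C := by
      intro n
      rw [← hP.pow_const hT n C]
      refine sup_le (hP.pow_mono n ((le_abs_self h).trans hh)) ?_
      rw [← map_neg]
      exact hP.pow_mono n ((neg_le_abs h).trans hh)
    have hSr : ∀ n : ℕ, |∑ k ∈ Finset.range n, (P ^ k) r| ≤ ∑ k ∈ Finset.range n, (P ^ k) |r| := by
      intro n
      refine sup_le (Finset.sum_le_sum fun k _ => hP.pow_mono k (le_abs_self r)) ?_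
      rw [← Finset.sum_neg_distrib]
      refine Finset.sum_le_sum fun k _ => ?_
      rw [← map_neg]
      exact hP.pow_mono k (neg_le_abs r)
    have hbound : ∀ n : ℕ, ∀ᵐ x ∂m, |∑ k ∈ Finset.range n, (P ^ k) f x - n|
        ≤ 2 * C + (∑ k ∈ Finset.range n, (P ^ k) |r| : Lp ℝ 1 m) x := by
      intro n
      filter_upwards [L1_coeFn_sum (Finset.range n) (fun k => (P ^ k) f),
        Lp.coeFn_add (Lp.const 1 m (n : ℝ) + (h - (P ^ n) h)) (∑ k ∈ Finset.range n, (P ^ k) r),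
        Lp.coeFn_add (Lp.const 1 m (n : ℝ)) (h - (P ^ n) h), Lp.coeFn_sub h ((P ^ n) h),
        Lp.coeFn_const (p := 1) (μ := m) (n : ℝ), Lp.coeFn_const (p := 1) (μ := m) C,
        (Lp.coeFn_le _ _).2 hh, (Lp.coeFn_le _ _).2 (hPh n), (Lp.coeFn_le _ _).2 (hSr n),
        Lp.coeFn_abs h, Lp.coeFn_abs ((P ^ n) h), Lp.coeFn_abs (∑ k ∈ Finset.range n, (P ^ k) r)]
        with x h1 h2 h3 h4 h5 h6 h7 h8 h9 h10 h11 h12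
      rw [← h1, hdecomp n, h2, Pi.add_apply, h3, Pi.add_apply, h4, Pi.sub_apply, h5]
      rw [h10, h6] at h7
      rw [h11, h6] at h8
      rw [h12] at h9
      simp only [Function.const_apply] at h7 h8 ⊢
      rw [abs_le] at h7 h8 h9 ⊢
      constructor <;> linarith [h7.1, h7.2, h8.1, h8.2, h9.1, h9.2]
    filter_upwards [ae_all_iff.2 hbound] with x hx hbad
    by_contra hgood
    refine hbad ?_
    have hg : ∀ n : ℕ, (∑ k ∈ Finset.range n, (P ^ k) |r| : Lp ℝ 1 m) x ≤ n * c := fun n =>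
      not_lt.1 fun hlt => hgood ⟨n, hlt⟩
    obtain ⟨K, hK⟩ := exists_nat_ge (2 * C / c)
    filter_upwards [eventually_ge_atTop K] with n hn
    have h1 : 2 * C ≤ n * c := by
      rw [← div_le_iff₀ hc]; exact hK.trans (by exact_mod_cast hn)
    linarith [hx n, hg n]
  have key' : ∀ᵐ x ∂m, ∀ j : ℕ, ∀ᶠ n : ℕ in atTop,
      |∑ k ∈ Finset.range n, (P ^ k) f x - n| ≤ n * (2 * (1 / ((j : ℝ) + 1))) :=
    ae_all_iff.2 fun j => key _ (by positivity)
  filter_upwards [key'] with x hx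
  rw [Metric.tendsto_nhds]
  intro ε hε
  obtain ⟨j, hj⟩ := exists_nat_one_div_lt (half_pos hε)
  filter_upwards [hx j, eventually_gt_atTop 0] with n hn hn0
  have hn0' : (0 : ℝ) < n := by exact_mod_cast hn0
  rw [Real.dist_eq, div_sub_one hn0'.ne', abs_div, abs_of_pos hn0', div_lt_iff₀ hn0']
  have : (n : ℝ) * (2 * (1 / ((j : ℝ) + 1))) < n * ε := by
    refine mul_lt_mul_of_pos_left ?_ hn0'
    linarith
  linarith

end Transfer

section StationaryMean

variable {X : Type*} [MeasurableSpace X] {T : X → X} {η m : Measure X}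

lemma IsStationaryMean.measurePreserving [IsProbabilityMeasure η] [IsFiniteMeasure m]
    (hTm : Measurable T) (h : IsStationaryMean T η m) : MeasurePreserving T m m := by
  refine ⟨hTm, Measure.ext fun F hF => ?_⟩
  rw [Measure.map_apply hTm hF]
  have h1 := h F hF
  have h2 := h _ (hTm hF)
  set a : ℕ → ℝ := fun k => (η (T^[k] ⁻¹' F)).toReal with ha
  have h3 : ∀ k, (η (T^[k] ⁻¹' (T ⁻¹' F))).toReal = a (k + 1) := fun k => by
    rw [← Set.preimage_comp, ← Function.iterate_succ']
  simp only [h3] at h2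
  have ha1 : ∀ k, |a k| ≤ 1 := fun k => by
    rw [abs_of_nonneg ENNReal.toReal_nonneg]
    exact measureReal_le_one
  have h4 : Tendsto (fun n : ℕ => (a n - a 0) / n) atTop (nhds 0) := by
    refine squeeze_zero_norm (a := fun n : ℕ => 2 / (n : ℝ)) (fun n => ?_)
      (tendsto_const_div_atTop_nhds_zero_nat 2)
    rw [Real.norm_eq_abs, abs_div, Nat.abs_cast]
    refine div_le_div_of_nonneg_right ?_ n.cast_nonneg
    exact (abs_sub _ _).trans (by linarith [ha1 n, ha1 0])
  have h5 : Tendsto (fun n : ℕ => (∑ k ∈ Finset.range n, a (k + 1)) / (n : ℝ)) atTop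
      (nhds (m F).toReal) := by
    refine (by simpa using h1.add h4 : Tendsto _ atTop (nhds (m F).toReal)).congr fun n => ?_
    rw [← add_div]
    congr 1
    have := Finset.sum_range_succ a n
    rw [Finset.sum_range_succ'] at this
    linarith
  exact (ENNReal.toReal_eq_toReal_iff' (measure_ne_top _ _) (measure_ne_top _ _)).1
    (tendsto_nhds_unique h2 h5)

lemma IsStationaryMean.apply_eq_of_invariant [IsFiniteMeasure η] [IsFiniteMeasure m]
    (h : IsStationaryMean T η m) {F : Set X} (hF : MeasurableSet F) (hinv : T ⁻¹' F = F) :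
    η F = m F := by
  have hk : ∀ k, T^[k] ⁻¹' F = F := fun k => by
    rw [Set.preimage_iterate_eq]
    exact Function.iterate_fixed hinv k
  have h1 := h F hF
  refine (ENNReal.toReal_eq_toReal_iff' (measure_ne_top _ _) (measure_ne_top _ _)).1
    (tendsto_nhds_unique (tendsto_const_nhds.congr' ?_) h1)
  filter_upwards [eventually_ne_atTop 0] with n hn
  have : (n : ℝ) ≠ 0 := by exact_mod_cast hn
  simp [hk, this]

/-- Recurrence implies infinite recurrence: almost every point of `F` returns to `F`
infinitely often. -/
lemma Recurrent.measure_diff_infinitely_often (hTm : Measurable T) (h : Recurrent T η)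
    {F : Set X} (hF : MeasurableSet F) : η (F \ ⋂ n : ℕ, ⋃ k : ℕ, T^[n + k] ⁻¹' F) = 0 := by
  set G : Set X := F \ ⋃ k : ℕ, T^[k + 1] ⁻¹' F with hG
  have hGm : MeasurableSet G := hF.diff (MeasurableSet.iUnion fun k => hTm.iterate _ hF)
  have hE : ∀ j : ℕ, η (F ∩ T^[j] ⁻¹' G) = 0 := by
    intro j
    have hr := h _ (hF.inter (hTm.iterate j hGm))
    rwa [sdiff_eq_left.2] at hr
    rw [Set.disjoint_left]
    rintro x ⟨-, -, hx⟩ hx'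
    obtain ⟨k, -, hk, -⟩ := Set.mem_iUnion.1 hx'
    refine hx (Set.mem_iUnion.2 ⟨k, ?_⟩)
    rwa [Set.mem_preimage, ← Function.iterate_add_apply, add_comm, Function.iterate_add_apply]
  refine measure_mono_null ?_ (measure_iUnion_null hE)
  rintro x ⟨hxF, hx⟩
  simp only [Set.mem_iInter, Set.mem_iUnion, Set.mem_preimage, not_forall, not_exists] at hx
  classical
  have hfind := Nat.find_spec hx
  have hmin := fun j => Nat.find_min hx (m := j)
  rcases hn : Nat.find hx with _ | n
  · rw [hn] at hfind
    exact absurd hxF (hfind 0)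
  · rw [hn] at hfind hmin
    have h1 := hmin n n.lt_succ_self
    push Not at h1
    obtain ⟨k, hk⟩ := h1
    refine Set.mem_iUnion.2 ⟨n, hxF, ?_, ?_⟩
    · cases k with
      | zero => exact hk
      | succ k =>
        exact absurd hk (by have := hfind k; rwa [show n + 1 + k = n + (k + 1) by omega] at this)
    · intro hmem
      obtain ⟨k, hk⟩ := Set.mem_iUnion.1 hmem
      rw [Set.mem_preimage, ← Function.iterate_add_apply] at hk
      exact hfind k (by rwa [show n + 1 + k = k + 1 + n by omega])

/-- A recurrent measure is absolutely continuous with respect to its stationary mean. -/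
lemma Recurrent.absolutelyContinuous_s14 [IsProbabilityMeasure η] [IsFiniteMeasure m]
    (hTm : Measurable T) (hr : Recurrent T η) (h : IsStationaryMean T η m) : η ≪ m := by
  have hT := h.measurePreserving hTm
  refine Measure.AbsolutelyContinuous.mk fun F hF hF0 => ?_
  set I : Set X := ⋂ n : ℕ, ⋃ k : ℕ, T^[n + k] ⁻¹' F with hI
  have hIm : MeasurableSet I :=
    MeasurableSet.iInter fun n => MeasurableSet.iUnion fun k => hTm.iterate _ hF
  have hinv : T ⁻¹' I = I := by
    ext x
    simp only [hI, Set.mem_preimage, Set.mem_iInter, Set.mem_iUnion, ← Function.iterate_succ_apply]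
    refine ⟨fun hx n => ?_, fun hx n => ?_⟩
    · obtain ⟨k, hk⟩ := hx n
      exact ⟨k + 1, hk⟩
    · obtain ⟨k, hk⟩ := hx (n + 1)
      exact ⟨k, by rwa [show (n + k).succ = n + 1 + k by omega]⟩
  have hmI : m I = 0 := by
    refine measure_mono_null (Set.iInter_subset _ 0) (measure_iUnion_null fun k => ?_)
    rw [(hT.iterate _).measure_preimage hF.nullMeasurableSet, hF0]
  have hηI : η I = 0 := by rw [h.apply_eq_of_invariant hIm hinv, hmI]
  refine measure_mono_null ?_ (measure_union_null (hr.measure_diff_infinitely_often hTm hF) hηI)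
  rw [← hI, Set.sdiff_union_self]
  exact Set.subset_union_left

end StationaryMean

/-- **Scheffé's lemma** for densities converging to the constant `1`. -/
lemma tendsto_setIntegral_of_ae_tendsto_one {Y : Type*} [MeasurableSpace Y] {ρ : Measure Y}
    [IsProbabilityMeasure ρ] {φ : ℕ → Y → ℝ} (hint : ∀ n, Integrable (φ n) ρ)
    (hnonneg : ∀ n, 0 ≤ᵐ[ρ] φ n) (hone : ∀ᶠ n in atTop, ∫ y, φ n y ∂ρ = 1)
    (hlim : ∀ᵐ y ∂ρ, Tendsto (fun n => φ n y) atTop (nhds 1)) (G : Set Y) :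
    Tendsto (fun n => ∫ y in G, φ n y ∂ρ) atTop (nhds (ρ.real G)) := by
  have hψint : ∀ n, Integrable (fun y => max (1 - φ n y) 0) ρ := fun n =>
    ((integrable_const 1).sub (hint n)).pos_part
  have hψ : Tendsto (fun n => ∫ y, max (1 - φ n y) 0 ∂ρ) atTop (nhds 0) := by
    have := tendsto_integral_of_dominated_convergence (μ := ρ)
      (F := fun n y => max (1 - φ n y) 0) (f := fun _ => 0) (fun _ => (1 : ℝ))
      (fun n => (hψint n).aestronglyMeasurable) (integrable_const _) ?_ ?_
    · simpa using this
    · intro n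
      filter_upwards [hnonneg n] with y hy
      have : 0 ≤ φ n y := hy
      rw [Real.norm_of_nonneg (le_max_right _ _)]
      exact max_le (by linarith) zero_le_one
    · filter_upwards [hlim] with y hy
      simpa using ((tendsto_const_nhds (x := (1 : ℝ))).sub hy).max
        (tendsto_const_nhds (x := (0 : ℝ)))
  rw [tendsto_iff_norm_sub_tendsto_zero]
  refine squeeze_zero' (Eventually.of_forall fun n => norm_nonneg _) ?_
    (by simpa using hψ.const_mul 2)
  filter_upwards [hone] with n hn
  have h1 : ∫ y in G, φ n y ∂ρ - ρ.real G = ∫ y in G, (φ n y - 1) ∂ρ := by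
    rw [integral_sub (hint n).integrableOn (integrable_const _)]
    simp
  have hsub : Integrable (fun y => φ n y - 1) ρ := (hint n).sub (integrable_const _)
  rw [h1]
  calc ‖∫ y in G, (φ n y - 1) ∂ρ‖ ≤ ∫ y in G, ‖φ n y - 1‖ ∂ρ := norm_integral_le_integral_norm _
    _ ≤ ∫ y, ‖φ n y - 1‖ ∂ρ :=
        setIntegral_le_integral hsub.norm (Eventually.of_forall fun y => norm_nonneg _)
    _ = ∫ y, ((φ n y - 1) + 2 * max (1 - φ n y) 0) ∂ρ := by
        refine integral_congr_ae (Eventually.of_forall fun y => ?_)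
        simp only [Real.norm_eq_abs]
        rcases le_total (φ n y) 1 with h | h
        · rw [abs_of_nonpos (by linarith), max_eq_left (by linarith)]; ring
        · rw [abs_of_nonneg (by linarith), max_eq_right (by linarith)]; ring
    _ = 2 * ∫ y, max (1 - φ n y) 0 ∂ρ := by
        rw [integral_add hsub ((hψint n).const_mul 2), integral_const_mul,
          integral_sub (hint n) (integrable_const _), hn]
        simp

lemma ae_setIntegral_eq_of_setIntegral_compProd {A B : Type*} [MeasurableSpace A]
    [MeasurableSpace B] {μ : Measure A} [IsFiniteMeasure μ] {κ ξ : Kernel A B} [IsMarkovKernel κ]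
    [IsMarkovKernel ξ] {u : A × B → ℝ} (hu : Integrable u (μ ⊗ₘ ξ))
    (h : ∀ F : Set (A × B), MeasurableSet F → ∫ z in F, u z ∂(μ ⊗ₘ ξ) = (μ ⊗ₘ κ).real F)
    {G : Set B} (hG : MeasurableSet G) :
    ∀ᵐ x ∂μ, ∫ y in G, u (x, y) ∂ξ x = (κ x G).toReal := by
  have hκ : Measurable fun x => κ x G := κ.measurable_coe hG
  have hint : Integrable (fun x => ∫ y in G, u (x, y) ∂ξ x) μ := by
    have h1 : Integrable ((Set.univ ×ˢ G).indicator u) (μ ⊗ₘ ξ) :=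
      hu.indicator (MeasurableSet.univ.prod hG)
    have h2 : Integrable (fun x => ∫ y, (Set.univ ×ˢ G).indicator u (x, y) ∂ξ x) μ := by
      rw [Measure.compProd] at h1
      simpa using h1.integral_compProd
    refine h2.congr (Eventually.of_forall fun x => ?_)
    dsimp only
    rw [← integral_indicator hG]
    refine integral_congr_ae (Eventually.of_forall fun y => ?_)
    by_cases hy : y ∈ G <;> simp [Set.indicator, hy]
  have hint2 : Integrable (fun x => (κ x G).toReal) μ :=
    Integrable.of_bound hκ.ennreal_toReal.aestronglyMeasurable 1
      (Eventually.of_forall fun x => by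
        rw [Real.norm_of_nonneg ENNReal.toReal_nonneg]; exact measureReal_le_one)
  refine Integrable.ae_eq_of_forall_setIntegral_eq _ _ hint hint2 fun F hF _ => ?_
  rw [← Measure.setIntegral_compProd hF hG hu.integrableOn, h _ (hF.prod hG), measureReal_def,
    Measure.compProd_apply_prod hF hG,
    integral_toReal hκ.aemeasurable (Eventually.of_forall fun x => measure_lt_top _ _)]

theorem stmt14 {A B : Type*} [MeasurableSpace A] [MeasurableSpace B]
    [StandardBorelSpace A] [StandardBorelSpace B]
    (TA : A → A) (TB : B → B) (hTA : Measurable TA) (hTB : Measurable TB)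
    (μ : Measure A) [IsProbabilityMeasure μ] (hμ : Stationary TA μ)
    (ν : Kernel A B) [IsMarkovKernel ν]
    (hrec : Recurrent (Prod.map TA TB) (μ ⊗ₘ ν))
    (hams : IsAMS (Prod.map TA TB) (μ ⊗ₘ ν))
    (νbar : Kernel A B) [IsMarkovKernel νbar]
    (hνbar : IsStationaryMean (Prod.map TA TB) (μ ⊗ₘ ν) (μ ⊗ₘ νbar))
    (νs : ℕ → Kernel A B) [∀ i, IsMarkovKernel (νs i)]
    (hνs : ∀ i : ℕ, μ ⊗ₘ (νs i) = (μ ⊗ₘ ν).map ((Prod.map TA TB)^[i])) :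
    ∀ G : Set B, MeasurableSet G → ∀ᵐ x ∂μ,
      Filter.Tendsto
        (fun n : ℕ => (∑ i ∈ Finset.range n, ((νs i) x G).toReal) / (n : ℝ))
        Filter.atTop (nhds ((νbar x G).toReal)) := by
  intro G hG
  set T : A × B → A × B := Prod.map TA TB with hTdef
  have hTm : Measurable T := hTA.prodMap hTB
  have hT : MeasurePreserving T (μ ⊗ₘ νbar) (μ ⊗ₘ νbar) := hνbar.measurePreserving hTm
  have hac : (μ ⊗ₘ ν) ≪ (μ ⊗ₘ νbar) := hrec.absolutelyContinuous_s14 hTm hνbar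
  obtain ⟨P, hP⟩ := exists_isTransferOp hT
  have hfi : Integrable (fun z => ((μ ⊗ₘ ν).rnDeriv (μ ⊗ₘ νbar) z).toReal) (μ ⊗ₘ νbar) :=
    Measure.integrable_toReal_rnDeriv
  set f : Lp ℝ 1 (μ ⊗ₘ νbar) := hfi.toL1 _ with hf
  have hf0 : 0 ≤ f := by
    rw [← Lp.coeFn_nonneg]
    filter_upwards [hfi.coeFn_toL1] with z hz
    rw [hf, hz]
    exact ENNReal.toReal_nonneg
  have hfint : ∀ F : Set (A × B), ∫ z in F, f z ∂(μ ⊗ₘ νbar) = (μ ⊗ₘ ν).real F := fun F => by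
    rw [← Measure.setIntegral_toReal_rnDeriv hac F]
    exact integral_congr_ae (ae_restrict_of_ae hfi.coeFn_toL1)
  have hPf : ∀ (k : ℕ) (F : Set (A × B)), MeasurableSet F →
      ∫ z in F, (P ^ k) f z ∂(μ ⊗ₘ νbar) = (μ ⊗ₘ ν).real (T^[k] ⁻¹' F) := fun k F hF => by
    rw [hP.setIntegral_pow hTm f k hF, hfint]
  have hconv := ae_tendsto_average_transfer hT hP hf0 fun F hF => by
    simp only [hPf _ F hF]
    exact hνbar F hF
  have hfib : ∀ (k : ℕ) {G : Set B}, MeasurableSet G →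
      ∀ᵐ x ∂μ, ∫ y in G, (P ^ k) f (x, y) ∂νbar x = (νs k x G).toReal := fun k G hG =>
    ae_setIntegral_eq_of_setIntegral_compProd (L1.integrable_coeFn _) (fun F hF => by
      rw [hPf k F hF, hνs k, measureReal_def, measureReal_def,
        Measure.map_apply (hTm.iterate k) hF]) hG
  have hpos : ∀ k : ℕ, ∀ᵐ z ∂(μ ⊗ₘ νbar), 0 ≤ (P ^ k) f z := fun k =>
    (Lp.coeFn_nonneg _).2 (by simpa using hP.pow_mono k hf0)
  have hint : ∀ k : ℕ, ∀ᵐ x ∂μ, Integrable (fun y => (P ^ k) f (x, y)) (νbar x) := fun k =>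
    ((Measure.integrable_compProd_iff (L1.integrable_coeFn _).aestronglyMeasurable).1
      (L1.integrable_coeFn ((P ^ k) f))).1
  filter_upwards [Measure.ae_ae_of_ae_compProd hconv,
    Measure.ae_ae_of_ae_compProd (ae_all_iff.2 hpos), ae_all_iff.2 hint,
    ae_all_iff.2 fun k => hfib k hG, ae_all_iff.2 fun k => hfib k MeasurableSet.univ]
    with x hx hx0 hxi hxG hxU
  have hsum : ∀ (n : ℕ) (H : Set B),
      ∫ y in H, (∑ k ∈ Finset.range n, (P ^ k) f (x, y)) / (n : ℝ) ∂νbar x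
        = (∑ k ∈ Finset.range n, ∫ y in H, (P ^ k) f (x, y) ∂νbar x) / n := fun n H => by
    rw [integral_div, integral_finsetSum _ fun k _ => (hxi k).integrableOn]
  refine (tendsto_setIntegral_of_ae_tendsto_one
    (fun n => (integrable_finsetSum _ fun k _ => hxi k).div_const (n : ℝ)) (fun n => ?_) ?_ hx
    G).congr fun n => ?_
  · filter_upwards [hx0] with y hy
    exact div_nonneg (Finset.sum_nonneg fun k _ => hy k) n.cast_nonneg
  · filter_upwards [eventually_ne_atTop 0] with n hn
    have hn' : (n : ℝ) ≠ 0 := by exact_mod_cast hn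
    rw [← setIntegral_univ, hsum n Set.univ]
    simp only [hxU]
    simp [hn']
  · rw [hsum n G]
    simp only [hxG]
end
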